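/- Let 𝒯_0 be a colored initial triangulation and let T ∈ 𝕄 be an arbitrary d-simplex of the master tree. Then: (1) the vertices of T have pairwise different generations; (2) the oldest vertex of T lies on the bisection edge bse(T); (3) T has a unique oldest edge ẽ, and gen(ẽ) ≤ gen(T) − d + 1; (4) every edge e of T satisfies level(e) ≤ level(T) ≤ level(e) + 1; (5) level(bse(T)) = level(T) − 1 if type(T) < d, and level(bse(T)) = level(T) if type(T) = d; (6) type(bse(T)) = 1 if and only if type(T) = d; (7) every face ((d−1)-subsimplex) F of T satisfies gen(F) ≤ gen(T) ≤ gen(F) + 1. -/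

import Mathlib

noncomputable section

namespace BisecGrading

/-- Points of `ℝ^d`. -/
abbrev Pt (d : ℕ) : Type := Fin d → ℝ

/-- Integer ceiling `⌈g / d⌉` (for `d > 0`). -/
def lvlZ (d : ℕ) (g : ℤ) : ℤ := (g + d - 1) / d

/-- The type `g - d * (⌈g/d⌉ - 1)` of a generation `g`. -/
def typZ (d : ℕ) (g : ℤ) : ℤ := g - d * (lvlZ d g - 1)

/-- A `d`-simplex, given by its ordered vertex list (in Maubach's ordering) together
with its generation counter. -/
structure Simplex (d : ℕ) where
  vertex : Fin (d + 1) → Pt d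
  gen : ℕ

namespace Simplex

variable {d : ℕ}

instance : DecidableEq (Simplex d) := Classical.decEq _

/-- Maubach's index `k = d - (gen T % d)`. -/
def k (T : Simplex d) : ℕ := d - T.gen % d

lemma k_le (T : Simplex d) : T.k ≤ d := Nat.sub_le _ _

/-- `k` as an index into the vertex list. -/
def kIdx (T : Simplex d) : Fin (d + 1) := ⟨T.k, Nat.lt_succ_of_le T.k_le⟩

/-- The bisection vertex `(v₀ + v_k)/2`. -/
def bsv (T : Simplex d) : Pt d := midpoint ℝ (T.vertex 0) (T.vertex T.kIdx)

/-- The bisection edge `[v₀, v_k]`, as an unordered pair of points. -/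
def bse (T : Simplex d) : Sym2 (Pt d) := s(T.vertex 0, T.vertex T.kIdx)

/-- The first child `[v₀, …, v_{k-1}, v', v_{k+1}, …, v_d]` of Maubach's bisection. -/
def child1 (T : Simplex d) : Simplex d where
  vertex := Function.update T.vertex T.kIdx T.bsv
  gen := T.gen + 1

/-- The second child `[v₁, …, v_k, v', v_{k+1}, …, v_d]` of Maubach's bisection. -/
def child2 (T : Simplex d) : Simplex d where
  vertex := fun i =>
    if h : (i : ℕ) < T.k then
      T.vertex ⟨(i : ℕ) + 1, by have hk := T.k_le; omega⟩
    else if (i : ℕ) = T.k then T.bsv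
    else T.vertex i
  gen := T.gen + 1

/-- `T'` is a child of `T`. -/
def IsChild (T' T : Simplex d) : Prop := T' = T.child1 ∨ T' = T.child2

/-- The vertex set `𝒱(T)`. -/
def V (T : Simplex d) : Set (Pt d) := Set.range T.vertex

/-- The edge set `ℰ(T)`. -/
def E (T : Simplex d) : Set (Sym2 (Pt d)) :=
  {e | ∃ i j : Fin (d + 1), i ≠ j ∧ e = s(T.vertex i, T.vertex j)}

/-- The closed simplex (convex hull of the vertices). -/
def hull (T : Simplex d) : Set (Pt d) := convexHull ℝ (Set.range T.vertex)

/-- The level `⌈gen/d⌉` of a `d`-simplex. -/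
def lvl (T : Simplex d) : ℤ := lvlZ d T.gen

/-- The type of a `d`-simplex. -/
def typ (T : Simplex d) : ℤ := typZ d T.gen

end Simplex

variable {d : ℕ}

/-- Membership in the master tree generated from the initial triangulation `T0`. -/
inductive MemM (T0 : Finset (Simplex d)) : Simplex d → Prop
  | init {T : Simplex d} : T ∈ T0 → MemM T0 T
  | child {T T' : Simplex d} : MemM T0 T → T'.IsChild T → MemM T0 T'

/-- `Refines 𝒯₁ 𝒯₂` : the partition `𝒯₂` is obtained from `𝒯₁` by finitely many
single bisections. -/
inductive Refines : Finset (Simplex d) → Finset (Simplex d) → Prop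
  | refl (𝒯 : Finset (Simplex d)) : Refines 𝒯 𝒯
  | step {𝒯₁ 𝒯₂ : Finset (Simplex d)} (T : Simplex d) :
      Refines 𝒯₁ 𝒯₂ → T ∈ 𝒯₂ →
      Refines 𝒯₁ (insert T.child1 (insert T.child2 (𝒯₂.erase T)))

/-- The subsimplex of `T` spanned by the vertex positions in `s`. -/
def faceSet (T : Simplex d) (s : Finset (Fin (d + 1))) : Set (Pt d) :=
  convexHull ℝ (T.vertex '' ↑s)

/-- Conformity: any two simplices meet in the empty set or in a common subsimplex. -/
def Conforming (𝒯 : Finset (Simplex d)) : Prop :=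
  ∀ T₁ ∈ 𝒯, ∀ T₂ ∈ 𝒯,
    T₁.hull ∩ T₂.hull = ∅ ∨
      ∃ s₁ s₂ : Finset (Fin (d + 1)), s₁.Nonempty ∧ s₂.Nonempty ∧
        T₁.hull ∩ T₂.hull = faceSet T₁ s₁ ∧ T₁.hull ∩ T₂.hull = faceSet T₂ s₂

/-- The conforming triangulations obtained from `T0` by successive bisections. -/
def Bisec (T0 : Finset (Simplex d)) : Set (Finset (Simplex d)) :=
  {𝒯 | Refines T0 𝒯 ∧ Conforming 𝒯}

/-- All vertices of a triangulation. -/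
def verticesOf (𝒯 : Finset (Simplex d)) : Set (Pt d) := ⋃ T ∈ 𝒯, T.V

/-- All edges of a triangulation. -/
def edgesOf (𝒯 : Finset (Simplex d)) : Set (Sym2 (Pt d)) := ⋃ T ∈ 𝒯, T.E

/-- Midpoint of an edge; this is the bisection vertex of the edge. -/
def edgeMid (e : Sym2 (Pt d)) : Pt d :=
  Sym2.lift ⟨fun a b => midpoint ℝ a b, fun a b => midpoint_comm a b⟩ e

/-- The closed segment covered by an edge. -/
def edgeSeg (e : Sym2 (Pt d)) : Set (Pt d) :=
  Sym2.lift ⟨fun a b => segment ℝ a b, fun a b => segment_symm ℝ a b⟩ e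

/-- A colored conforming initial triangulation (with the vertices of each initial
simplex ordered so that the colors read `(d, 0, 1, …, d-1)`), together with the
induced generation function on all vertices of the master tree. -/
structure ColoredSetup (d : ℕ) where
  T0 : Finset (Simplex d)
  indep : ∀ T ∈ T0, AffineIndependent ℝ T.vertex
  gen_zero : ∀ T ∈ T0, T.gen = 0
  conf : Conforming T0
  disjInt : ∀ T₁ ∈ T0, ∀ T₂ ∈ T0, T₁ ≠ T₂ → interior T₁.hull ∩ interior T₂.hull = ∅
  color : Pt d → ℕ
  color_zero : ∀ T ∈ T0, color (T.vertex 0) = d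
  color_succ : ∀ T ∈ T0, ∀ i : Fin (d + 1), (i : ℕ) ≠ 0 → color (T.vertex i) = (i : ℕ) - 1
  vgen : Pt d → ℤ
  vgen_init : ∀ T ∈ T0, ∀ i : Fin (d + 1), vgen (T.vertex i) = -(color (T.vertex i) : ℤ)
  vgen_bsv : ∀ T : Simplex d, MemM T0 T → vgen T.bsv = (T.gen : ℤ) + 1

namespace ColoredSetup

variable {d : ℕ} (S : ColoredSetup d)

/-- Level of a vertex. -/
def lvlV (v : Pt d) : ℤ := lvlZ d (S.vgen v)

/-- Type of a vertex. -/
def typV (v : Pt d) : ℤ := typZ d (S.vgen v)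

/-- Generation of an edge: the maximal generation of its endpoints. -/
def genE (e : Sym2 (Pt d)) : ℤ :=
  Sym2.lift ⟨fun a b => max (S.vgen a) (S.vgen b), fun a b => max_comm _ _⟩ e

/-- Level of an edge. -/
def lvlE (e : Sym2 (Pt d)) : ℤ := lvlZ d (S.genE e)

/-- Type of an edge. -/
def typE (e : Sym2 (Pt d)) : ℤ := typZ d (S.genE e)

/-- `gen#` of an edge: the generation of its bisection vertex (= its midpoint). -/
def genSharpE (e : Sym2 (Pt d)) : ℤ := S.vgen (edgeMid e)

/-- `level#` of an edge. -/
def lvlSharpE (e : Sym2 (Pt d)) : ℤ := lvlZ d (S.genSharpE e)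

/-- `type#` of an edge. -/
def typSharpE (e : Sym2 (Pt d)) : ℤ := typZ d (S.genSharpE e)

end ColoredSetup

/-- Chains of pairwise intersecting simplices of length `N`. -/
def IsSimChain (𝒮 : Set (Simplex d)) (T T' : Simplex d) (N : ℕ) : Prop :=
  ∃ f : Fin (N + 1) → Simplex d, (∀ i, f i ∈ 𝒮) ∧ f 0 = T ∧ f (Fin.last N) = T' ∧
    ∀ i : Fin N, ((f i.castSucc).hull ∩ (f i.succ).hull).Nonempty

/-- The simplex distance `δ_𝒯`. -/
def simDist (𝒯 : Finset (Simplex d)) (T T' : Simplex d) : ℕ :=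
  sInf {N | IsSimChain (↑𝒯) T T' N}

/-- Chains of `1`-neighbours (consecutive simplices share an edge). -/
def Is1Chain (𝒮 : Set (Simplex d)) (T T' : Simplex d) (N : ℕ) : Prop :=
  ∃ f : Fin (N + 1) → Simplex d, (∀ i, f i ∈ 𝒮) ∧ f 0 = T ∧ f (Fin.last N) = T' ∧
    ∀ i : Fin N, ((f i.castSucc).E ∩ (f i.succ).E).Nonempty

/-- The `1`-distance `δ¹_𝒮`. -/
def dist1 (𝒮 : Set (Simplex d)) (T T' : Simplex d) : ℕ :=
  sInf {N | Is1Chain 𝒮 T T' N}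

/-- The uniform patch `ω_{𝒯₀⁺}(v)` in the full uniform refinement `𝒯₀⁺`. -/
def patchPlus (S : ColoredSetup d) (v : Pt d) : Set (Simplex d) :=
  {T | MemM S.T0 T ∧ T.gen = d ∧ v ∈ T.V}

/-- The constant `C(𝒯₀)`. -/
def Cconst (S : ColoredSetup d) : ℕ :=
  sSup {n | ∃ v ∈ verticesOf S.T0, ∃ T ∈ patchPlus S v, ∃ T' ∈ patchPlus S v,
    n = dist1 (patchPlus S v) T T'}

/-- `v` lies in some `n`-subsimplex of an initial simplex. -/
def InMacroSub (S : ColoredSetup d) (n : ℕ) (v : Pt d) : Prop :=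
  ∃ T ∈ S.T0, ∃ s : Finset (Fin (d + 1)), s.card = n + 1 ∧ v ∈ convexHull ℝ (T.vertex '' ↑s)

/-- `v` is an `n`-macro vertex. -/
def IsMacro (S : ColoredSetup d) (n : ℕ) (v : Pt d) : Prop :=
  InMacroSub S n v ∧ ∀ m : ℕ, m < n → ¬ InMacroSub S m v

/-- The maximal level jump at a vertex `v`. -/
def jump (S : ColoredSetup d) (v : Pt d) : ℕ :=
  sSup {n | ∃ 𝒯 ∈ Bisec S.T0, ∃ e ∈ edgesOf 𝒯, ∃ e' ∈ edgesOf 𝒯,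
    v ∈ e ∧ v ∈ e' ∧ (n : ℤ) = |S.lvlE e - S.lvlE e'|}

/-- The constants `J_n`. -/
def J (S : ColoredSetup d) (n : ℕ) : ℤ :=
  if n = 0 then ⌈((Cconst S : ℚ) + 1) * (1 - 1 / (d : ℚ))⌉ - 2
  else if n ≤ d - 2 then 2 else 0

/-- The constant `Γ = 1 + Σ_{n=0}^{d-2} J_n`. -/
def Gam (S : ColoredSetup d) : ℤ := 1 + ∑ n ∈ Finset.range (d - 1), J S n

/-- The edges spanned by a set of points. -/
def edgeOfSet (A : Set (Pt d)) : Set (Sym2 (Pt d)) :=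
  {e | ∃ a ∈ A, ∃ b ∈ A, a ≠ b ∧ e = s(a, b)}

/-- `FirstBisected A T e` : along descendants of `T` that keep all points of `A` as
vertices, `e` is the first edge spanned by points of `A` which occurs as a bisection
edge, i.e. the edge of the subsimplex spanned by `A` that is bisected first. -/
inductive FirstBisected (A : Set (Pt d)) : Simplex d → Sym2 (Pt d) → Prop
  | found {T : Simplex d} : T.bse ∈ edgeOfSet A → FirstBisected A T T.bse
  | step {T T' : Simplex d} {e : Sym2 (Pt d)} :
      T.bse ∉ edgeOfSet A → T'.IsChild T → A ⊆ T'.V →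
      FirstBisected A T' e → FirstBisected A T e

/-- The uniform vertex patch `ω_m(v)`. -/
def patchU (S : ColoredSetup d) (m : ℕ) (v : Pt d) : Set (Simplex d) :=
  {T | MemM S.T0 T ∧ T.gen = m * d ∧ v ∈ T.V}

/-- The patch boundary `∂ω_m(v)`: union of the `(d-1)`-subsimplices of members of
`ω_m(v)` not containing `v`. -/
def patchBd (S : ColoredSetup d) (m : ℕ) (v : Pt d) : Set (Pt d) :=
  ⋃ T ∈ patchU S m v,
    ⋃ s ∈ {s : Finset (Fin (d + 1)) | s.card = d ∧ v ∉ convexHull ℝ (T.vertex '' ↑s)},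
      convexHull ℝ (T.vertex '' ↑s)

/-- The neighbourhood `Ω_m(v)`. -/
def nbhd (S : ColoredSetup d) (m : ℕ) (v : Pt d) : Set (Pt d) :=
  (⋃ T ∈ patchU S m v, T.hull) \ patchBd S m v

/-- The Kuhn simplex `T_π = [0, e_{π(1)}, e_{π(1)}+e_{π(2)}, …]`, of generation `0`. -/
def kuhnSimplex (d : ℕ) (π : Equiv.Perm (Fin d)) : Simplex d where
  vertex := fun i x => if ((π.symm x : ℕ)) < (i : ℕ) then 1 else 0
  gen := 0

/-- The average diameter `h₀` of the initial triangulation. -/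
def avgDiam (T0 : Finset (Simplex d)) : ℝ :=
  (∑ T ∈ T0, Metric.diam T.hull) / T0.card

/-- The regularized mesh size function `h_𝒯`. -/
def regMesh (T0 𝒯 : Finset (Simplex d)) (T : Simplex d) : ℝ :=
  avgDiam T0 * sInf {x : ℝ | ∃ T' ∈ 𝒯, x = (2 : ℝ) ^ (-(T'.lvl) + (simDist 𝒯 T T' : ℤ))}

/-- The generations of the vertices of a simplex of generation `l * d + r`: the vertices at
positions beyond `d - r` were created since generation `l * d`, the others form a window with
offset `a` of the vertex list of an ancestor of generation `l * d`. -/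
structure VertexPattern (S : ColoredSetup d) (T : Simplex d) (l r a : ℕ) : Prop where
  lt : r < d
  le : a ≤ r
  gen_eq : T.gen = l * d + r
  recent : ∀ i : Fin (d + 1), d - r < (i : ℕ) →
    S.vgen (T.vertex i) = ((l * d : ℕ) : ℤ) + d - (i : ℕ) + 1
  window : ∀ i : Fin (d + 1), 1 ≤ (i : ℕ) → (i : ℕ) ≤ d - r →
    S.vgen (T.vertex i) = ((l * d : ℕ) : ℤ) - (a + (i : ℕ)) + 1
  head_pos : 1 ≤ a → S.vgen (T.vertex 0) = ((l * d : ℕ) : ℤ) - a + 1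
  head_zero : a = 0 → S.vgen (T.vertex 0) ≤ ((l * d : ℕ) : ℤ) - d

namespace VertexPattern

variable {S : ColoredSetup d} {T : Simplex d} {l r a : ℕ}

lemma k_eq (h : VertexPattern S T l r a) : T.k = d - r := by
  have := h.lt
  rw [Simplex.k, h.gen_eq, Nat.mul_add_mod', Nat.mod_eq_of_lt this]

lemma vgen_zero_le (h : VertexPattern S T l r a) :
    S.vgen (T.vertex 0) ≤ ((l * d : ℕ) : ℤ) := by
  rcases Nat.eq_zero_or_pos a with ha | ha
  · have := h.head_zero ha
    omega
  · have := h.head_pos ha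
    omega

lemma child1_vertex_of_ne (T : Simplex d) (i : Fin (d + 1)) (hi : (i : ℕ) ≠ T.k) :
    T.child1.vertex i = T.vertex i :=
  Function.update_of_ne (fun h => hi (congrArg Fin.val h)) _ _

lemma child1_vertex_of_eq (T : Simplex d) (i : Fin (d + 1)) (hi : (i : ℕ) = T.k) :
    T.child1.vertex i = T.bsv := by
  obtain rfl : i = T.kIdx := Fin.ext hi
  exact Function.update_self _ _ _

lemma child2_vertex_of_lt (T : Simplex d) (i j : Fin (d + 1)) (hi : (i : ℕ) < T.k)
    (hj : (j : ℕ) = i + 1) : T.child2.vertex i = T.vertex j := by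
  have : j = ⟨(i : ℕ) + 1, by omega⟩ := Fin.ext hj
  simp [Simplex.child2, hi, this]

lemma child2_vertex_of_eq (T : Simplex d) (i : Fin (d + 1)) (hi : (i : ℕ) = T.k) :
    T.child2.vertex i = T.bsv := by
  simp [Simplex.child2, hi]

lemma child2_vertex_of_gt (T : Simplex d) (i : Fin (d + 1)) (hi : T.k < (i : ℕ)) :
    T.child2.vertex i = T.vertex i := by
  simp [Simplex.child2, hi.not_gt, hi.ne']

lemma of_mem (hd : 2 ≤ d) (hT : T ∈ S.T0) : VertexPattern S T 0 0 0 where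
  lt := by omega
  le := le_rfl
  gen_eq := by simp [S.gen_zero T hT]
  recent i hi := by omega
  window i hi _ := by
    rw [S.vgen_init T hT, S.color_succ T hT i (by omega)]
    push_cast [hi]
    ring
  head_pos h := by omega
  head_zero _ := by
    rw [S.vgen_init T hT, S.color_zero T hT]
    simp

/-- Completing a level: all vertices but the one in front have been created since. -/
lemma next_level {T' : Simplex d} (h : VertexPattern S T l r a) (hr : r + 1 = d)
    (hgen : T'.gen = T.gen + 1)
    (hnew : ∀ i : Fin (d + 1), (i : ℕ) = T.k → S.vgen (T'.vertex i) = (T.gen : ℤ) + 1)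
    (hold : ∀ i : Fin (d + 1), T.k < (i : ℕ) → T'.vertex i = T.vertex i)
    (hzero : S.vgen (T'.vertex 0) ≤ ((l * d : ℕ) : ℤ)) :
    VertexPattern S T' (l + 1) 0 0 := by
  have hk := h.k_eq
  have hg := h.gen_eq
  have hm : (l + 1) * d = l * d + d := by ring
  refine ⟨by omega, le_rfl, by omega, fun i hi => by omega, fun i hi _ => ?_,
    fun h => by omega, fun _ => by omega⟩
  rcases Nat.lt_or_ge T.k i with hi' | hi'
  · rw [hold i hi', h.recent i (by omega)]
    omega
  · rw [hnew i (by omega)]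
    omega

lemma child1 (h : VertexPattern S T l r a) (hT : MemM S.T0 T) (hr : r + 1 < d) :
    VertexPattern S T.child1 l (r + 1) a := by
  have hk := h.k_eq
  have hg := h.gen_eq
  have ha := h.le
  have h0 : T.child1.vertex 0 = T.vertex 0 := child1_vertex_of_ne T 0 (by simp; omega)
  refine ⟨hr, by omega, by simp only [Simplex.child1]; omega, fun i hi => ?_,
    fun i hi hi' => ?_, fun h1 => by rw [h0, h.head_pos h1], fun h1 => by
      rw [h0]; exact h.head_zero h1⟩
  · rcases Nat.lt_or_ge T.k i with hi' | hi'
    · rw [child1_vertex_of_ne T i (by omega), h.recent i (by omega)]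
    · rw [child1_vertex_of_eq T i (by omega), S.vgen_bsv T hT]
      omega
  · rw [child1_vertex_of_ne T i (by omega), h.window i hi (by omega)]

lemma child2 (h : VertexPattern S T l r a) (hT : MemM S.T0 T) (hr : r + 1 < d) :
    VertexPattern S T.child2 l (r + 1) (a + 1) := by
  have hk := h.k_eq
  have hg := h.gen_eq
  have ha := h.le
  refine ⟨hr, by omega, by simp only [Simplex.child2]; omega, fun i hi => ?_,
    fun i hi hi' => ?_, fun _ => ?_, fun h1 => by omega⟩
  · rcases Nat.lt_or_ge T.k i with hi' | hi'
    · rw [child2_vertex_of_gt T i (by omega), h.recent i (by omega)]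
    · rw [child2_vertex_of_eq T i (by omega), S.vgen_bsv T hT]
      omega
  · rw [child2_vertex_of_lt T i ⟨i + 1, by omega⟩ (by omega) rfl,
      h.window _ (by simp) (by simp only; omega)]
    push_cast
    ring
  · rw [child2_vertex_of_lt T 0 ⟨1, by omega⟩ (by simp; omega) (by simp),
      h.window _ le_rfl (by simp only; omega)]
    push_cast
    ring

lemma exists_of_memM (hd : 2 ≤ d) (hT : MemM S.T0 T) :
    ∃ l r a, VertexPattern S T l r a := by
  induction hT with
  | init h => exact ⟨0, 0, 0, of_mem hd h⟩
  | @child T T' hT hc ih =>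
    obtain ⟨l, r, a, h⟩ := ih
    have hk := h.k_eq
    have hlt := h.lt
    rcases Nat.lt_or_ge (r + 1) d with hr | hr
    · rcases hc with rfl | rfl
      · exact ⟨_, _, _, h.child1 hT hr⟩
      · exact ⟨_, _, _, h.child2 hT hr⟩
    · refine ⟨l + 1, 0, 0, ?_⟩
      rcases hc with rfl | rfl
      · refine h.next_level (by omega) rfl
          (fun i hi => by rw [child1_vertex_of_eq T i hi, S.vgen_bsv T hT])
          (fun i hi => child1_vertex_of_ne T i (by omega)) ?_
        rw [child1_vertex_of_ne T 0 (by simp; omega)]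
        exact h.vgen_zero_le
      · refine h.next_level (by omega) rfl
          (fun i hi => by rw [child2_vertex_of_eq T i hi, S.vgen_bsv T hT])
          (fun i hi => child2_vertex_of_gt T i (by omega)) ?_
        rw [child2_vertex_of_lt T 0 ⟨1, by omega⟩ (by simp; omega) (by simp),
          h.window _ le_rfl (by simp only; omega)]
        simp only
        omega

/-- All cases for the generation of one vertex. -/
lemma vgen_cases (h : VertexPattern S T l r a) (i : Fin (d + 1)) :
    (d - r < (i : ℕ) ∧ S.vgen (T.vertex i) = ((l * d : ℕ) : ℤ) + d - (i : ℕ) + 1) ∨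
    ((1 ≤ (i : ℕ) ∨ 1 ≤ a) ∧ (i : ℕ) ≤ d - r ∧
      S.vgen (T.vertex i) = ((l * d : ℕ) : ℤ) - (a + (i : ℕ)) + 1) ∨
    ((i : ℕ) = 0 ∧ a = 0 ∧ S.vgen (T.vertex i) ≤ ((l * d : ℕ) : ℤ) - d) := by
  rcases Nat.lt_or_ge (d - r) i with hi | hi
  · exact Or.inl ⟨hi, h.recent i hi⟩
  rcases Nat.eq_zero_or_pos (i : ℕ) with h0 | h0
  · obtain rfl : i = 0 := Fin.ext h0
    rcases Nat.eq_zero_or_pos a with ha | ha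
    · exact Or.inr (Or.inr ⟨h0, ha, h.head_zero ha⟩)
    · exact Or.inr (Or.inl ⟨Or.inr ha, hi, by rw [h.head_pos ha]; simp⟩)
  · exact Or.inr (Or.inl ⟨Or.inl h0, hi, h.window i h0 hi⟩)

lemma vgen_ne (h : VertexPattern S T l r a) {i j : Fin (d + 1)} (hij : i ≠ j) :
    S.vgen (T.vertex i) ≠ S.vgen (T.vertex j) := by
  have hij' : (i : ℕ) ≠ j := fun e => hij (Fin.ext e)
  have h1 := h.lt
  have h2 := h.le
  rcases h.vgen_cases i with hi | hi | hi <;> rcases h.vgen_cases j with hj | hj | hj <;> omega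

lemma vgen_le (h : VertexPattern S T l r a) (i : Fin (d + 1)) :
    S.vgen (T.vertex i) ≤ (T.gen : ℤ) := by
  have hg := h.gen_eq
  have h1 := h.lt
  rcases h.vgen_cases i with hi | hi | hi <;> omega

/-- The two oldest vertices. -/
lemma exists_oldest (h : VertexPattern S T l r a) : ∃ p q : Fin (d + 1), p ≠ q ∧
    (p = 0 ∨ p = T.kIdx) ∧ S.vgen (T.vertex p) < S.vgen (T.vertex q) ∧
    (∀ i, i ≠ p → i ≠ q → S.vgen (T.vertex q) < S.vgen (T.vertex i)) ∧
    S.vgen (T.vertex q) ≤ (T.gen : ℤ) - d + 1 ∧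
    ((l * d : ℕ) : ℤ) - d + 1 ≤ S.vgen (T.vertex q) := by
  have hg := h.gen_eq
  have h1 := h.lt
  have h2 := h.le
  have hk := h.k_eq
  rcases Nat.eq_zero_or_pos a with ha | ha
  · have hz := h.head_zero ha
    have hq := h.window T.kIdx (by simp [Simplex.kIdx]; omega) (by simp [Simplex.kIdx]; omega)
    simp only [Simplex.kIdx] at hq
    refine ⟨0, T.kIdx, ?_, Or.inl rfl, ?_, fun i hi hi' => ?_, ?_, ?_⟩
    · intro e
      have := congrArg Fin.val e
      simp [Simplex.kIdx] at this
      omega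
    · simp only [Simplex.kIdx]; omega
    · have hi0 : (i : ℕ) ≠ 0 := fun e => hi (Fin.ext e)
      have hik : (i : ℕ) ≠ T.k := fun e => hi' (Fin.ext e)
      simp only [Simplex.kIdx]
      rcases h.vgen_cases i with hc | hc | hc <;> omega
    · simp only [Simplex.kIdx]; omega
    · simp only [Simplex.kIdx]; omega
  · have hp := h.window T.kIdx (by simp [Simplex.kIdx]; omega) (by simp [Simplex.kIdx]; omega)
    simp only [Simplex.kIdx] at hp
    have hq := h.vgen_cases ⟨T.k - 1, by omega⟩
    simp only at hq
    refine ⟨T.kIdx, ⟨T.k - 1, by omega⟩, ?_, Or.inr rfl, ?_, fun i hi hi' => ?_, ?_, ?_⟩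
    · intro e
      have := congrArg Fin.val e
      simp [Simplex.kIdx] at this
      omega
    · simp only [Simplex.kIdx]; omega
    · have hik : (i : ℕ) ≠ T.k := fun e => hi (Fin.ext e)
      have hi0 : (i : ℕ) ≠ T.k - 1 := fun e => hi' (Fin.ext e)
      rcases h.vgen_cases i with hc | hc | hc <;> omega
    · omega
    · omega

/-- The two youngest vertices. -/
lemma exists_youngest (hd : 2 ≤ d) (h : VertexPattern S T l r a) : ∃ p q : Fin (d + 1), p ≠ q ∧
    (T.gen : ℤ) ≤ S.vgen (T.vertex p) + 1 ∧ (T.gen : ℤ) ≤ S.vgen (T.vertex q) + 1 := by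
  have hg := h.gen_eq
  have h1 := h.lt
  have h2 := h.le
  obtain ⟨p, q, hpq, hp, hq⟩ : ∃ p q : ℕ, p ≠ q ∧
      (∃ hp : p < d + 1, (T.gen : ℤ) ≤ S.vgen (T.vertex ⟨p, hp⟩) + 1) ∧
      (∃ hq : q < d + 1, (T.gen : ℤ) ≤ S.vgen (T.vertex ⟨q, hq⟩) + 1) := by
    have key (n : ℕ) (hn : n < d + 1) := h.vgen_cases ⟨n, hn⟩
    simp only at key
    rcases Nat.lt_or_ge r 1 with hr | hr
    · have k1 := key 1 (by omega)
      have k2 := key 2 (by omega)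
      exact ⟨1, 2, by omega, ⟨by omega, by omega⟩, ⟨by omega, by omega⟩⟩
    have k1 := key (d - r + 1) (by omega)
    rcases Nat.lt_or_ge r 2 with hr' | hr'
    · have k2 := key (1 - a) (by omega)
      exact ⟨d - r + 1, 1 - a, by omega, ⟨by omega, by omega⟩, ⟨by omega, by omega⟩⟩
    · have k2 := key (d - r + 2) (by omega)
      exact ⟨d - r + 1, d - r + 2, by omega, ⟨by omega, by omega⟩, ⟨by omega, by omega⟩⟩
  exact ⟨_, _, fun e => hpq (congrArg Fin.val e), hp.2, hq.2⟩

/-- The generation of the bisection edge. -/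
lemma genE_bse (h : VertexPattern S T l r a) :
    S.genE T.bse ≤ ((l * d : ℕ) : ℤ) ∧ ((l * d : ℕ) : ℤ) - d + 1 ≤ S.genE T.bse ∧
      (S.genE T.bse = ((l * d : ℕ) : ℤ) - d + 1 ↔ r = 0) := by
  have h1 := h.lt
  have h2 := h.le
  have hk := h.k_eq
  have hp := h.window T.kIdx (by simp [Simplex.kIdx]; omega) (by simp [Simplex.kIdx]; omega)
  simp only [Simplex.kIdx] at hp
  have hb : S.genE T.bse = max (S.vgen (T.vertex 0)) (S.vgen (T.vertex T.kIdx)) := rfl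
  simp only [Simplex.kIdx] at hb
  rcases Nat.eq_zero_or_pos a with ha | ha
  · have hz := h.head_zero ha
    omega
  · have hz := h.head_pos ha
    omega

end VertexPattern

lemma lvlZ_mono {d : ℕ} (hd : 0 < d) {x y : ℤ} (h : x ≤ y) : lvlZ d x ≤ lvlZ d y :=
  Int.ediv_le_ediv (by omega) (by omega)

lemma lvlZ_eq {d : ℕ} (m x : ℤ) (h1 : m * d - d < x) (h2 : x ≤ m * d) : lvlZ d x = m := by
  have hd : (0 : ℤ) < d := by omega
  rw [lvlZ, Int.ediv_eq_iff_of_pos hd]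
  constructor <;> linarith

theorem fine_properties (d : ℕ) (hd : 2 ≤ d) (S : ColoredSetup d)
    (T : Simplex d) (hT : MemM S.T0 T) :
    (∀ i j : Fin (d + 1), i ≠ j → S.vgen (T.vertex i) ≠ S.vgen (T.vertex j)) ∧
    (∀ i : Fin (d + 1), (∀ j : Fin (d + 1), S.vgen (T.vertex i) ≤ S.vgen (T.vertex j)) →
      T.vertex i ∈ T.bse) ∧
    (∃ e, (e ∈ T.E ∧ ∀ e' ∈ T.E, e' ≠ e → S.genE e < S.genE e') ∧
      S.genE e ≤ (T.gen : ℤ) - d + 1) ∧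
    (∀ e ∈ T.E, S.lvlE e ≤ T.lvl ∧ T.lvl ≤ S.lvlE e + 1) ∧
    ((T.typ < d → S.lvlE T.bse = T.lvl - 1) ∧ (T.typ = d → S.lvlE T.bse = T.lvl)) ∧
    (S.typE T.bse = 1 ↔ T.typ = d) ∧
    (∀ s : Finset (Fin (d + 1)), s.card = d →
      (∀ i ∈ s, S.vgen (T.vertex i) ≤ (T.gen : ℤ)) ∧
      (∃ i ∈ s, (T.gen : ℤ) ≤ S.vgen (T.vertex i) + 1)) := by
  obtain ⟨l, r, a, h⟩ := VertexPattern.exists_of_memM hd hT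
  have hr := h.lt
  have hg : (T.gen : ℤ) = l * d + r := by exact_mod_cast h.gen_eq
  obtain ⟨p, q, hpq, hpb, hlt, hrest, hle, hge⟩ := h.exists_oldest
  obtain ⟨hb1, hb2, hb3⟩ := h.genE_bse
  push_cast at hge hb1 hb2 hb3
  have hbl : S.lvlE T.bse = l := lvlZ_eq _ _ (by omega) hb1
  have hTl0 : r = 0 → T.lvl = l := fun h0 => lvlZ_eq _ _ (by omega) (by omega)
  have hTl1 : r ≠ 0 → T.lvl = l + 1 := fun h0 =>
    lvlZ_eq _ _ (by rw [add_mul]; omega) (by rw [add_mul]; omega)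
  have hT0 : r = 0 → T.typ = d := fun h0 => by
    have e : T.typ = T.gen - d * (T.lvl - 1) := rfl
    rw [e, hTl0 h0, hg, h0]
    push_cast
    ring
  have hT1 : r ≠ 0 → T.typ = r := fun h0 => by
    have e : T.typ = T.gen - d * (T.lvl - 1) := rfl
    rw [e, hTl1 h0, hg]
    ring
  have hsecond : ∀ i j, i ≠ j → S.vgen (T.vertex q) ≤ S.genE s(T.vertex i, T.vertex j) ∧
      (s(T.vertex i, T.vertex j) ≠ s(T.vertex p, T.vertex q) →
        S.vgen (T.vertex q) < S.genE s(T.vertex i, T.vertex j)) := by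
    intro i j hij
    have hmax : S.genE s(T.vertex i, T.vertex j) =
      max (S.vgen (T.vertex i)) (S.vgen (T.vertex j)) := rfl
    have hi := hrest i
    have hj := hrest j
    by_cases hip : i = p
    · by_cases hjq : j = q
      · subst hip hjq
        exact ⟨by omega, fun hne => absurd rfl hne⟩
      · have := hj (fun e => hij (hip.trans e.symm)) hjq
        exact ⟨by omega, fun _ => by omega⟩
    · by_cases hiq : i = q
      · by_cases hjp : j = p
        · subst hiq hjp
          exact ⟨by omega, fun hne => absurd Sym2.eq_swap hne⟩
        · have := hj hjp (fun e => hij (hiq.trans e.symm))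
          exact ⟨by omega, fun _ => by omega⟩
      · have := hi hip hiq
        exact ⟨by omega, fun _ => by omega⟩
  have hgenpq : S.genE s(T.vertex p, T.vertex q) = S.vgen (T.vertex q) := max_eq_right hlt.le
  refine ⟨fun i j => h.vgen_ne, ?_, ⟨s(T.vertex p, T.vertex q), ⟨⟨p, q, hpq, rfl⟩, ?_⟩, ?_⟩,
    ?_, ⟨fun ht => ?_, fun ht => ?_⟩, ?_, ?_⟩
  · intro i hi
    have hip : i = p := by
      by_contra hip
      by_cases hiq : i = q
      · subst hiq
        exact (hi p).not_gt hlt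
      · exact (hi p).not_gt (hlt.trans (hrest i hip hiq))
    rcases hpb with hp | hp <;> simp [hip, hp, Simplex.bse]
  · rintro _ ⟨i, j, hij, rfl⟩ hne
    rw [hgenpq]
    exact (hsecond i j hij).2 hne
  · rw [hgenpq]
    exact hle
  · rintro _ ⟨i, j, hij, rfl⟩
    refine ⟨lvlZ_mono (by omega) (max_le (h.vgen_le i) (h.vgen_le j)), ?_⟩
    have h1 : (l : ℤ) ≤ S.lvlE s(T.vertex i, T.vertex j) := by
      rw [← lvlZ_eq (d := d) l (l * d - d + 1) (by omega) (by omega)]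
      exact lvlZ_mono (by omega) (hge.trans (hsecond i j hij).1)
    by_cases h0 : r = 0
    · have := hTl0 h0
      omega
    · have := hTl1 h0
      omega
  · have h0 : r ≠ 0 := fun h0 => by have := hT0 h0; omega
    rw [hbl, hTl1 h0]
    ring
  · have h0 : r = 0 := by
      by_contra h0
      have := hT1 h0
      omega
    rw [hbl, hTl0 h0]
  · have e : S.typE T.bse = S.genE T.bse - d * (S.lvlE T.bse - 1) := rfl
    have e' : (d : ℤ) * (l - 1) = l * d - d := by ring
    rw [e, hbl, e']
    by_cases h0 : r = 0
    · have := hb3.2 h0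
      have := hT0 h0
      omega
    · have := hT1 h0
      have : S.genE T.bse ≠ l * d - d + 1 := fun e => h0 (hb3.1 e)
      omega
  · intro s hs
    refine ⟨fun i _ => h.vgen_le i, ?_⟩
    obtain ⟨u, v, huv, hu, hv⟩ := h.exists_youngest hd
    by_cases hus : u ∈ s
    · exact ⟨u, hus, hu⟩
    by_cases hvs : v ∈ s
    · exact ⟨v, hvs, hv⟩
    have hcard := Finset.card_le_univ (insert u (insert v s))
    rw [Finset.card_insert_of_notMem (by simp [huv, hus]), Finset.card_insert_of_notMem hvs,
      Fintype.card_fin] at hcard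
    omega

end BisecGrading
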